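/- arXiv:0809.3232 — 2 statements merged into one kernel-verified Lean document; each statement's English description precedes it below -/
import Mathlib

section
/- For every entrywise nonnegative vector p ∈ ℝ^n and every x ∈ [0, vol(V)], I(M p, x) ≤ I(p, x). -/
open Matrix BigOperators

/-- The Lovász–Simonovits curve: `I(p,x)` is the supremum (in fact maximum) of
`∑_u w(u) p(u)` over fractional vertex-selections `w ∈ [0,1]^n` of total degree-weight `x`. -/
noncomputable def curveI {n : ℕ} (d : Fin n → ℝ) (p : Fin n → ℝ) (x : ℝ) : ℝ :=
  sSup {y : ℝ | ∃ w : Fin n → ℝ, (∀ u, 0 ≤ w u ∧ w u ≤ 1) ∧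
    (∑ u, w u * d u) = x ∧ y = ∑ u, w u * p u}

/-- The values defining the curve of a nonnegative vector are bounded above by its total mass. -/
theorem bddAbove_curveI_values {n : ℕ} (d p : Fin n → ℝ) (hp : ∀ u, 0 ≤ p u) (x : ℝ) :
    BddAbove {y : ℝ | ∃ w : Fin n → ℝ, (∀ u, 0 ≤ w u ∧ w u ≤ 1) ∧
      (∑ u, w u * d u) = x ∧ y = ∑ u, w u * p u} := by
  refine ⟨∑ u, p u, ?_⟩
  rintro y ⟨w, hw, -, rfl⟩
  exact Finset.sum_le_sum fun u _ => mul_le_of_le_one_left (hp u) (hw u).2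

/-- The curve of a nonnegative vector is nonnegative. -/
theorem curveI_nonneg {n : ℕ} (d p : Fin n → ℝ) (hp : ∀ u, 0 ≤ p u) (x : ℝ) :
    0 ≤ curveI d p x := by
  apply Real.sSup_nonneg
  rintro y ⟨w, hw, -, rfl⟩
  exact Finset.sum_nonneg fun u _ => mul_nonneg (hw u).1 (hp u)

/-- A nonnegative column-stochastic matrix fixing the weight vector `d` does not raise
the curve: a selection `w` for `M *ᵥ p` pulls back to the selection `w ᵥ* M` for `p`. -/
theorem curveI_mulVec_le {n : ℕ} (M : Matrix (Fin n) (Fin n) ℝ) (d : Fin n → ℝ)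
    (hM0 : ∀ u v, 0 ≤ M u v) (hcol : ∀ v, ∑ u, M u v = 1) (hfix : M *ᵥ d = d)
    (p : Fin n → ℝ) (hp : ∀ u, 0 ≤ p u) (x : ℝ) :
    curveI d (M *ᵥ p) x ≤ curveI d p x := by
  refine Real.sSup_le ?_ (curveI_nonneg d p hp x)
  rintro y ⟨w, hw, hwx, rfl⟩
  refine le_csSup (bddAbove_curveI_values d p hp x) ⟨w ᵥ* M, fun v => ⟨?_, ?_⟩, ?_, ?_⟩
  · change 0 ≤ ∑ u, w u * M u v
    exact Finset.sum_nonneg fun u _ => mul_nonneg (hw u).1 (hM0 u v)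
  · rw [← hcol v]
    change ∑ u, w u * M u v ≤ _
    exact Finset.sum_le_sum fun u _ => mul_le_of_le_one_left (hM0 u v) (hw u).2
  · change (w ᵥ* M) ⬝ᵥ d = x
    rw [← dotProduct_mulVec, hfix]
    exact hwx
  · exact dotProduct_mulVec w M p

/-- For every entrywise nonnegative `p` and every `x ∈ [0, vol(V)]`,
`I(M p, x) ≤ I(p, x)`. -/
theorem stmt7 (n : ℕ) (A : Matrix (Fin n) (Fin n) ℝ)
    (hA : A.IsSymm) (hA0 : ∀ u v, 0 ≤ A u v)
    (d : Fin n → ℝ) (hd : ∀ u, d u = ∑ v, A u v) (hdpos : ∀ u, 0 < d u)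
    (M : Matrix (Fin n) (Fin n) ℝ)
    (hM : M = (1/2 : ℝ) • (A * Matrix.diagonal (fun u => (d u)⁻¹) + 1))
    (p : Fin n → ℝ) (hp : ∀ u, 0 ≤ p u)
    (x : ℝ) (hx : x ∈ Set.Icc 0 (∑ u, d u)) :
    curveI d (M.mulVec p) x ≤ curveI d p x := by
  have hcolA : ∀ v, ∑ u, A u v = d v := fun v => by
    rw [hd v]
    exact Finset.sum_congr rfl fun u _ => hA.apply v u
  have hne : ∀ u, d u ≠ 0 := fun u => (hdpos u).ne'
  refine curveI_mulVec_le M d (fun u v => ?_) (fun v => ?_) ?_ p hp x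
  · have h1 : 0 ≤ (1 : Matrix (Fin n) (Fin n) ℝ) u v := by
      rw [one_apply]
      split_ifs <;> norm_num
    have h2 : 0 ≤ A u v * (d v)⁻¹ := mul_nonneg (hA0 u v) (inv_nonneg.2 (hdpos v).le)
    simp only [hM, Matrix.smul_apply, Matrix.add_apply, mul_diagonal, smul_eq_mul]
    linarith
  · simp only [hM, Matrix.smul_apply, Matrix.add_apply, mul_diagonal, smul_eq_mul]
    rw [← Finset.mul_sum, Finset.sum_add_distrib, ← Finset.sum_mul, hcolA,
      mul_inv_cancel₀ (hne v)]
    simp [one_apply]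
    norm_num
  · have h1 : diagonal (fun u => (d u)⁻¹) *ᵥ d = fun _ => 1 := by
      ext u
      simp [mulVec_diagonal, hne u]
    have h2 : A *ᵥ (fun _ => 1) = d := by
      ext u
      simp [mulVec, dotProduct, hd u]
    rw [hM, smul_mulVec, add_mulVec, ← mulVec_mulVec, h1, h2, one_mulVec]
    ext u
    simp only [Pi.smul_apply, Pi.add_apply, smul_eq_mul]
    ring
end

section
/- Let m > 0 and for y ∈ [0, 2m] set f(y) = √(min(y, 2m − y)). For every φ ∈ [0, 1] and every x ∈ [0, 2m], setting x̂ = min(x, 2m − x), if x − 2φx̂ ≥ 0 and x + 2φx̂ ≤ 2m, then (1/2)·( f(x − 2φx̂) + f(x + 2φx̂) ) ≤ f(x)·(1 − φ²/2). -/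
/-- The sum of two square roots at relative distance `2φ` from `h` falls short of `2√h`
by at least the relative amount `φ² / 2`. -/
theorem sqrt_sub_add_sqrt_add_le {φ h : ℝ} (hφ0 : 0 ≤ φ) (hh : 0 ≤ h)
    (hsub : 0 ≤ h - 2 * φ * h) :
    √(h - 2 * φ * h) + √(h + 2 * φ * h) ≤ √h * (2 - φ ^ 2) := by
  rcases hh.eq_or_lt with rfl | hpos
  · simp
  have hφ : 0 ≤ 1 - 2 * φ := by
    by_contra! hneg
    nlinarith [mul_neg_of_pos_of_neg hpos hneg]
  have key : √(1 - 2 * φ) + √(1 + 2 * φ) ≤ 2 - φ ^ 2 := by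
    have hprod : √(1 - 2 * φ) * √(1 + 2 * φ) ≤ 1 - 2 * φ ^ 2 := by
      rw [← Real.sqrt_mul hφ]
      refine Real.sqrt_le_iff.mpr ⟨by nlinarith, by nlinarith [sq_nonneg (φ ^ 2)]⟩
    refine abs_le_of_sq_le_sq' ?_ (by nlinarith) |>.2
    nlinarith [Real.sq_sqrt hφ, Real.sq_sqrt (by linarith : 0 ≤ 1 + 2 * φ), sq_nonneg (φ ^ 2)]
  calc √(h - 2 * φ * h) + √(h + 2 * φ * h)
      = √h * (√(1 - 2 * φ) + √(1 + 2 * φ)) := by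
        rw [mul_add, ← Real.sqrt_mul hh, ← Real.sqrt_mul hh]
        ring_nf
    _ ≤ √h * (2 - φ ^ 2) := mul_le_mul_of_nonneg_left key (Real.sqrt_nonneg h)


/-- The Lovász–Simonovits analytic inequality: for `f(y) = √(min(y, 2m−y))` on `[0,2m]`,
`φ ∈ [0,1]`, `x ∈ [0,2m]` and `x̂ = min(x, 2m−x)`, if `x − 2φx̂ ≥ 0` and `x + 2φx̂ ≤ 2m`,
then `(1/2)(f(x − 2φx̂) + f(x + 2φx̂)) ≤ f(x)(1 − φ²/2)`. -/
theorem stmt14 (m : ℝ) (hm : 0 < m) (φ x : ℝ)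
    (hφ0 : 0 ≤ φ) (hφ1 : φ ≤ 1) (hx0 : 0 ≤ x) (hx2m : x ≤ 2 * m)
    (xhat : ℝ) (hxhat : xhat = min x (2 * m - x))
    (hlo : 0 ≤ x - 2 * φ * xhat) (hhi : x + 2 * φ * xhat ≤ 2 * m) :
    (1/2) * (Real.sqrt (min (x - 2 * φ * xhat) (2 * m - (x - 2 * φ * xhat))) +
        Real.sqrt (min (x + 2 * φ * xhat) (2 * m - (x + 2 * φ * xhat)))) ≤
      Real.sqrt (min x (2 * m - x)) * (1 - φ ^ 2 / 2) := by
  rw [← hxhat]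
  have hh : 0 ≤ xhat := hxhat ▸ le_min hx0 (by linarith)
  rcases min_choice x (2 * m - x) with hmin | hmin <;> rw [hmin] at hxhat
  · have core := sqrt_sub_add_sqrt_add_le hφ0 hh (by linarith)
    have hleft := Real.sqrt_le_sqrt ((min_le_left (x - 2 * φ * xhat)
      (2 * m - (x - 2 * φ * xhat))).trans_eq (by linarith : _ = xhat - 2 * φ * xhat))
    have hright := Real.sqrt_le_sqrt ((min_le_left (x + 2 * φ * xhat)
      (2 * m - (x + 2 * φ * xhat))).trans_eq (by linarith : _ = xhat + 2 * φ * xhat))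
    linarith
  · have core := sqrt_sub_add_sqrt_add_le hφ0 hh (by linarith)
    have hleft := Real.sqrt_le_sqrt ((min_le_right (x - 2 * φ * xhat)
      (2 * m - (x - 2 * φ * xhat))).trans_eq (by linarith : _ = xhat + 2 * φ * xhat))
    have hright := Real.sqrt_le_sqrt ((min_le_right (x + 2 * φ * xhat)
      (2 * m - (x + 2 * φ * xhat))).trans_eq (by linarith : _ = xhat - 2 * φ * xhat))
    linarith
end
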